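/- Let n ≥ 2 and suppose ∫_1^∞ (f(ζ) ζ)^{−1/2} dζ < ∞ and ∫_0^1 f(r) r^{−2 − 2/(n−1)} dr = ∞. Then every global weak solution u of u_tt − Δu ≥ f(|u|) in ℝ^{n+1}_+ with u(·,0) = u_0 and u_t(·,0) = u_1 is trivial, i.e. u = 0 almost everywhere in ℝ^{n+1}_+. -/

import Mathlib

open MeasureTheory Real Set Filter

noncomputable section

/-- The spatial domain `ℝⁿ`. -/
abbrev Spc (n : ℕ) := EuclideanSpace ℝ (Fin n)

/-- The open ball `B_r` in `ℝⁿ` of radius `r` centered at `0`. -/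
def ball0 (n : ℕ) (r : ℝ) : Set (Spc n) := Metric.ball 0 r

/-- The cylinder `Q_r^κ = B_r × (0, r^κ)`. -/
def cyl (n : ℕ) (r κ : ℝ) : Set (Spc n × ℝ) := ball0 n r ×ˢ Ioo 0 (r ^ κ)

/-- The half-space `ℝ^{n+1}_+ = ℝⁿ × (0, ∞)`. -/
def halfSp (n : ℕ) : Set (Spc n × ℝ) := {z | 0 < z.2}

/-- The (finite) set of multi-indices `α` with `|α| = m`. -/
def mIdx (n m : ℕ) : Finset (Fin n → ℕ) :=
  (Fintype.piFinset fun _ : Fin n => Finset.range (m + 1)).filter fun α => ∑ i, α i = m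

/-- Spatial partial derivative `∂/∂x_i`. -/
def spDeriv (n : ℕ) (i : Fin n) (φ : Spc n × ℝ → ℝ) : Spc n × ℝ → ℝ :=
  fun z => deriv (fun s : ℝ => φ (z.1 + s • EuclideanSpace.single i (1 : ℝ), z.2)) 0

/-- Time derivative `∂/∂t`. -/
def tDeriv (n : ℕ) (φ : Spc n × ℝ → ℝ) : Spc n × ℝ → ℝ :=
  fun z => deriv (fun s : ℝ => φ (z.1, s)) z.2

/-- Multi-index spatial derivative `∂^α`. -/
def mDeriv (n : ℕ) (α : Fin n → ℕ) (φ : Spc n × ℝ → ℝ) : Spc n × ℝ → ℝ :=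
  (List.finRange n).foldr (fun i ψ => (spDeriv n i)^[α i] ψ) φ

/-- Caratheodory conditions and the growth bound `|a_α(x,t,ζ)| ≤ A |ζ|^p` for the
coefficients of the operator `L`. -/
def GoodCoeffs (n m : ℕ) (A p : ℝ) (a : (Fin n → ℕ) → Spc n × ℝ → ℝ → ℝ) : Prop :=
  ∀ α ∈ mIdx n m,
    (∀ ζ : ℝ, Measurable fun z => a α z ζ) ∧
    (∀ᵐ z ∂(volume.restrict (halfSp n)), Continuous fun ζ => a α z ζ) ∧
    (∀ᵐ z ∂(volume.restrict (halfSp n)), ∀ ζ : ℝ, |a α z ζ| ≤ A * |ζ| ^ p)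

/-- The standing conditions on `f`: `ζ ↦ f ζ` and `ζ ↦ f (ζ^{1/p})` are nondecreasing
and convex on `[0,∞)`, and `f` is positive on `(0,∞)`. -/
def GoodF (p : ℝ) (f : ℝ → ℝ) : Prop :=
  MonotoneOn f (Ici 0) ∧ ConvexOn ℝ (Ici 0) f ∧
  MonotoneOn (fun ζ => f (ζ ^ (1 / p))) (Ici 0) ∧
  ConvexOn ℝ (Ici 0) (fun ζ => f (ζ ^ (1 / p))) ∧
  ∀ ζ : ℝ, 0 < ζ → 0 < f ζ

/-- Condition (1.4): `∫_1^∞ ζ^{1/k - 1} f(ζ)^{-1/k} dζ < ∞`. -/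
def Cond14 (k : ℕ) (f : ℝ → ℝ) : Prop :=
  IntegrableOn (fun ζ : ℝ => ζ ^ ((k : ℝ)⁻¹ - 1) / f ζ ^ ((k : ℝ)⁻¹)) (Ioi 1)

/-- Condition (1.5): `∫_1^∞ ζ^{p/m - 1} f(ζ)^{-1/m} dζ < ∞`. -/
def Cond15 (m : ℕ) (p : ℝ) (f : ℝ → ℝ) : Prop :=
  IntegrableOn (fun ζ : ℝ => ζ ^ (p / (m : ℝ) - 1) / f ζ ^ ((m : ℝ)⁻¹)) (Ioi 1)

/-- `v ∈ L^1_loc(ℝⁿ)`. -/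
def L1locInit (n : ℕ) (v : Spc n → ℝ) : Prop :=
  ∀ r : ℝ, 0 < r → IntegrableOn v (ball0 n r)

/-- `u` is a global weak solution of
`∂_t^k u - Σ_{|α| = m} ∂^α a_α(x,t,u) ≥ f(|u|)` in `ℝ^{n+1}_+`, with initial data
`∂_t^i u(·,0) = u0 i` for `0 ≤ i ≤ k-1`. -/
def IsGlobalWeakSol (n k m : ℕ) (p : ℝ) (a : (Fin n → ℕ) → Spc n × ℝ → ℝ → ℝ)
    (f : ℝ → ℝ) (u0 : ℕ → Spc n → ℝ) (u : Spc n × ℝ → ℝ) : Prop :=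
  (∀ r : ℝ, 0 < r → IntegrableOn u (cyl n r 1)) ∧
  (∀ r : ℝ, 0 < r → IntegrableOn (fun z => |u z| ^ p) (cyl n r 1)) ∧
  (∀ r : ℝ, 0 < r → IntegrableOn (fun z => f |u z|) (cyl n r 1)) ∧
  ∀ φ : Spc n × ℝ → ℝ, ContDiff ℝ (⊤ : ℕ∞) φ → HasCompactSupport φ →
    (∀ z, 0 ≤ φ z) →
    (∫ z in halfSp n, (-1 : ℝ) ^ k * u z * (tDeriv n)^[k] φ z)
      - (∫ z in halfSp n, ∑ α ∈ mIdx n m, (-1 : ℝ) ^ m * a α z (u z) * mDeriv n α φ z)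
    ≥ (∫ x : Spc n, ∑ i ∈ Finset.range k,
          (-1 : ℝ) ^ i * u0 (k - 1 - i) x * (tDeriv n)^[i] φ (x, 0))
      + ∫ z in halfSp n, f |u z| * φ z

/-- `u = 0` almost everywhere in `ℝ^{n+1}_+`. -/
def TrivialSol (n : ℕ) (u : Spc n × ℝ → ℝ) : Prop :=
  ∀ᵐ z ∂(volume.restrict (halfSp n)), u z = 0

/-- `u` is a global weak solution of the wave inequality
`u_tt - Δu ≥ f(|u|)` in `ℝ^{n+1}_+` with `u(·,0) = u0`, `u_t(·,0) = u1`. -/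
def IsGlobalWeakSolWave (n : ℕ) (f : ℝ → ℝ) (u0 u1 : Spc n → ℝ)
    (u : Spc n × ℝ → ℝ) : Prop :=
  (∀ r : ℝ, 0 < r → IntegrableOn u (cyl n r 1)) ∧
  (∀ r : ℝ, 0 < r → IntegrableOn (fun z => f |u z|) (cyl n r 1)) ∧
  ∀ φ : Spc n × ℝ → ℝ, ContDiff ℝ (⊤ : ℕ∞) φ → HasCompactSupport φ →
    (∀ z, 0 ≤ φ z) →
    (∫ z in halfSp n, u z * ((tDeriv n)^[2] φ z - ∑ i : Fin n, (spDeriv n i)^[2] φ z))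
    ≥ (∫ x : Spc n, (u1 x * φ (x, 0) - u0 x * tDeriv n φ (x, 0)))
      + ∫ z in halfSp n, f |u z| * φ z

lemma rpow_neg_sub_rpow_neg_ge {p b x y : ℝ} (hp : 0 < p) (hb : 0 < b) (hx : 0 < x)
    (hxy : x ≤ y) (hyx : y * b ≤ x) :
    p * b ^ (1 + p) * ((y - x) * x ^ (-1 - p)) ≤ x ^ (-p) - y ^ (-p) := by
  have hy : 0 < y := hx.trans_le hxy
  have h1 : 1 + p * (1 - x / y) ≤ (x / y) ^ (-p) := by
    rw [rpow_def_of_pos (by positivity)]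
    have h2 := log_le_sub_one_of_pos (div_pos hx hy)
    have h3 := add_one_le_exp (log (x / y) * -p)
    nlinarith
  have h2 : p * (y - x) * y ^ (-1 - p) ≤ x ^ (-p) - y ^ (-p) := by
    rw [div_rpow hx.le hy.le, le_div_iff₀ (by positivity)] at h1
    have h3 : y ^ (-1 - p) = y ^ (-p) / y := by
      rw [show -1 - p = -p - 1 by ring, rpow_sub_one hy.ne']
    rw [h3]
    have h4 : p * (y - x) * (y ^ (-p) / y) = p * (1 - x / y) * y ^ (-p) := by
      field_simp
    rw [h4]; linarith
  have h3 : b ^ (1 + p) * x ^ (-1 - p) ≤ y ^ (-1 - p) := by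
    have h4 : (x / b) ^ (-1 - p) ≤ y ^ (-1 - p) :=
      rpow_le_rpow_of_nonpos hy ((le_div_iff₀ hb).2 hyx) (by linarith)
    rw [div_rpow hx.le hb.le, div_eq_mul_inv, ← rpow_neg hb.le] at h4
    rwa [mul_comm, show 1 + p = -(-1 - p) by ring]
  refine le_trans ?_ h2
  have := mul_le_mul_of_nonneg_left h3 (mul_nonneg hp.le (sub_nonneg.2 hxy))
  linarith

lemma intervalIntegrable_mul_rpow {f : ℝ → ℝ} (hf : MonotoneOn f (Ici 0)) (q : ℝ) {a b : ℝ}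
    (ha : 0 < a) (hb : 0 < b) :
    IntervalIntegrable (fun s : ℝ => f s * s ^ q) volume a b := by
  have hsub : uIcc a b ⊆ Ioi 0 := fun s hs =>
    lt_of_lt_of_le (lt_min ha hb) hs.1
  refine IntervalIntegrable.mul_continuousOn ?_ ?_
  · exact (hf.mono fun s hs => mem_Ici.2 (mem_Ioi.1 (hsub hs)).le).intervalIntegrable
  · exact fun s hs => (continuousAt_rpow_const s q (Or.inl (hsub hs).ne')).continuousWithinAt

lemma integral_le_of_doubling {n : ℕ} (hn : 2 ≤ n) {f : ℝ → ℝ} (hf : MonotoneOn f (Ici 0))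
    {c ρ e e' x x' p b : ℝ}
    (hc : 0 < c) (hρ : 0 < ρ) (he : 0 < e) (hp : p = 2 / ((n : ℝ) - 1)) (hb : b = 2 / 2 ^ n)
    (hx : x = c * e * ρ / ρ ^ n) (hx' : x' = c * e' * (2 * ρ) / (2 * ρ) ^ n)
    (hf0 : ∀ s, 0 < s → 0 < f s)
    (hee : e + c * ρ ^ n * ρ * f x ≤ e') :
    ∫ s in x'..x, f s * s ^ (-2 - p) ≤
      c ^ (-2 - p) * b ^ (-2 - p) / (p * b ^ (1 + p)) * (e ^ (-p) - e' ^ (-p)) := by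
  have hn1 : (0 : ℝ) < (n : ℝ) - 1 := by
    have : (2 : ℝ) ≤ n := by exact_mod_cast hn
    linarith
  have hp0 : 0 < p := by rw [hp]; positivity
  have hb0 : 0 < b := by rw [hb]; positivity
  have hx0 : 0 < x := by rw [hx]; positivity
  have hfx := hf0 x hx0
  have hle : e ≤ e' := by
    have : 0 ≤ c * ρ ^ n * ρ * f x := by positivity
    linarith
  have he' : 0 < e' := he.trans_le hle
  have hx'0 : 0 < x' := by rw [hx']; positivity
  have hrel : x' * e = b * x * e' := by
    rw [hx', hx, hb, mul_pow]; field_simp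
  have hK : 0 < c ^ (-2 - p) * b ^ (-2 - p) / (p * b ^ (1 + p)) := by positivity
  rcases le_or_gt x x' with hxx | hxx
  · refine le_trans (b := 0) ?_ ?_
    · rw [intervalIntegral.integral_symm]
      refine neg_nonpos.2 (intervalIntegral.integral_nonneg hxx fun s hs => ?_)
      have hs0 : 0 < s := hx0.trans_le hs.1
      have := hf0 s hs0
      positivity
    · refine mul_nonneg hK.le (sub_nonneg.2 ?_)
      exact rpow_le_rpow_of_nonpos he hle (by linarith)
  have hbx : b * x ≤ x' := by
    have : b * x * e ≤ x' * e := by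
      rw [hrel]; gcongr
    exact le_of_mul_le_mul_right this he
  have heb : e' * b ≤ e := by
    have : e' * b * x ≤ e * x := by nlinarith
    exact le_of_mul_le_mul_right this hx0
  have h1 : ∫ s in x'..x, f s * s ^ (-2 - p) ≤ f x * (b * x) ^ (-2 - p) * (x - x') := by
    rw [mul_comm, ← smul_eq_mul (x - x'), ← intervalIntegral.integral_const]
    refine intervalIntegral.integral_mono_on hxx.le
      (intervalIntegrable_mul_rpow hf _ hx'0 hx0) intervalIntegrable_const fun s hs => ?_
    have hs0 : 0 < s := hx'0.trans_le hs.1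
    refine mul_le_mul (hf hs0.le hx0.le hs.2) ?_ (by positivity) hfx.le
    exact rpow_le_rpow_of_nonpos (by positivity) (hbx.trans hs.1) (by linarith)
  have h2 : f x * (b * x) ^ (-2 - p) * (x - x') ≤
      b ^ (-2 - p) * (f x * x ^ (-1 - p)) := by
    have : f x * (b * x) ^ (-2 - p) * (x - x') ≤ f x * (b * x) ^ (-2 - p) * x := by
      gcongr; linarith
    refine this.trans (le_of_eq ?_)
    rw [mul_rpow hb0.le hx0.le, show -1 - p = (-2 - p) + 1 by ring, rpow_add_one hx0.ne']
    ring
  have h3 : f x * x ^ (-1 - p) ≤ c ^ (-2 - p) * ((e' - e) * e ^ (-1 - p)) := by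
    have hxp : x ^ (-1 - p) = (ρ ^ n * ρ) * (c * e) ^ (-1 - p) := by
      have e1 : x = (c * e) * ρ ^ (-((n : ℝ) - 1)) := by
        rw [hx, neg_sub, rpow_sub hρ, rpow_one, rpow_natCast]; ring
      rw [e1, mul_rpow (by positivity) (by positivity), ← rpow_mul hρ.le,
        show -((n : ℝ) - 1) * (-1 - p) = n + 1 by rw [hp]; field_simp; ring,
        rpow_add_one hρ.ne', rpow_natCast]
      ring
    rw [hxp, mul_rpow hc.le he.le]
    have e2 : c * (ρ ^ n * ρ) * f x ≤ e' - e := by linarith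
    have e3 : c ^ (-1 - p) = c ^ (-2 - p) * c := by
      rw [← rpow_add_one hc.ne']; congr 1; ring
    calc f x * (ρ ^ n * ρ * (c ^ (-1 - p) * e ^ (-1 - p)))
        = c ^ (-2 - p) * e ^ (-1 - p) * (c * (ρ ^ n * ρ) * f x) := by rw [e3]; ring
      _ ≤ c ^ (-2 - p) * e ^ (-1 - p) * (e' - e) := by gcongr
      _ = _ := by ring
  have h4 := rpow_neg_sub_rpow_neg_ge hp0 hb0 he hle heb
  calc _ ≤ b ^ (-2 - p) * (c ^ (-2 - p) * ((e' - e) * e ^ (-1 - p))) :=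
        h1.trans (h2.trans (by gcongr))
    _ = c ^ (-2 - p) * b ^ (-2 - p) / (p * b ^ (1 + p)) *
        (p * b ^ (1 + p) * ((e' - e) * e ^ (-1 - p))) := by
        field_simp
    _ ≤ _ := by gcongr

lemma exists_lower_bound_of_doubling {n : ℕ} (hn : 2 ≤ n) {f : ℝ → ℝ}
    (hf : MonotoneOn f (Ici 0)) (hf0 : ∀ s, 0 < s → 0 < f s)
    (hdiv : ¬ IntegrableOn (fun r : ℝ => f r * r ^ (-2 - 2 / ((n : ℝ) - 1))) (Ioo 0 1))
    {E : ℝ → ℝ} {c r : ℝ} (hc : 0 < c) (hr : 0 < r) 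
    (hE : ∀ R, 0 < R → E R + c * R ^ n * R * f (c * E R * R / R ^ n) ≤ E (2 * R))
    (hE0 : ∀ j : ℕ, 0 < E (r * 2 ^ j)) :
    ∃ μ, 0 < μ ∧ ∀ j : ℕ, μ ≤ c * E (r * 2 ^ j) * (r * 2 ^ j) / (r * 2 ^ j) ^ n := by
  by_contra! hcon
  apply hdiv
  obtain ⟨p, hp⟩ : ∃ p, p = 2 / ((n : ℝ) - 1) := ⟨_, rfl⟩
  obtain ⟨b, hb⟩ : ∃ b : ℝ, b = 2 / 2 ^ n := ⟨_, rfl⟩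
  have hp0 : 0 < p := by
    have : (2 : ℝ) ≤ n := by exact_mod_cast hn
    rw [hp]; apply div_pos two_pos; linarith
  have hb0 : 0 < b := by rw [hb]; positivity
  rw [← hp]
  set x : ℕ → ℝ := fun j => c * E (r * 2 ^ j) * (r * 2 ^ j) / (r * 2 ^ j) ^ n with hx
  have hx0 : ∀ j, 0 < x j := fun j => by
    have := hE0 j
    simp only [hx]; positivity
  set K := c ^ (-2 - p) * b ^ (-2 - p) / (p * b ^ (1 + p))
  have hK : 0 < K := by positivity
  have hi := fun {a b : ℝ} (ha : 0 < a) (hb : 0 < b) =>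
    intervalIntegrable_mul_rpow hf (-2 - p) ha hb
  have hstep : ∀ j, ∫ s in (x j)..1, f s * s ^ (-2 - p) ≤
      (∫ s in (x 0)..1, f s * s ^ (-2 - p)) + K * (E r ^ (-p) - E (r * 2 ^ j) ^ (-p)) := by
    intro j
    induction j with
    | zero => simp
    | succ j ih =>
      have hj : r * 2 ^ (j + 1) = 2 * (r * 2 ^ j) := by ring
      have h := integral_le_of_doubling hn hf hc (ρ := r * 2 ^ j) (by positivity) (hE0 j) hp hb
        (x := x j) (x' := x (j + 1)) rfl (by simp only [hx, hj]) hf0 (hE _ (by positivity))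
      rw [← intervalIntegral.integral_add_adjacent_intervals
        (hi (hx0 (j + 1)) (hx0 j)) (hi (hx0 j) one_pos), hj]
      have : K * (E r ^ (-p) - E (2 * (r * 2 ^ j)) ^ (-p)) =
        K * (E r ^ (-p) - E (r * 2 ^ j) ^ (-p)) +
          K * (E (r * 2 ^ j) ^ (-p) - E (2 * (r * 2 ^ j)) ^ (-p)) := by ring
      linarith
  choose j hj using fun i : ℕ => hcon (1 / ((i : ℝ) + 1)) (by positivity)
  have hlim : Tendsto (fun i => x (j i)) atTop (nhds 0) :=
    squeeze_zero (fun i => (hx0 _).le) (fun i => (hj i).le) tendsto_one_div_add_atTop_nhds_zero_nat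
  have hx1 : ∀ i, x (j i) ≤ 1 := fun i => (hj i).le.trans (by
    rw [div_le_one (by positivity)]
    have : (0 : ℝ) ≤ i := by positivity
    linarith)
  refine IntegrableOn.mono_set (t := Ioc 0 1) ?_ Ioo_subset_Ioc_self
  refine integrableOn_Ioc_of_intervalIntegral_norm_bounded_left
    (I := (∫ s in (x 0)..1, f s * s ^ (-2 - p)) + K * E r ^ (-p)) (fun i => ?_) hlim
    (Eventually.of_forall fun i => ?_)
  · exact (intervalIntegrable_iff_integrableOn_Ioc_of_le (hx1 i)).1 (hi (hx0 _) one_pos)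
  · rw [← intervalIntegral.integral_of_le (hx1 i)]
    have : ∫ s in (x (j i))..1, ‖f s * s ^ (-2 - p)‖ = ∫ s in (x (j i))..1, f s * s ^ (-2 - p) := by
      refine intervalIntegral.integral_congr fun s hs => ?_
      rw [uIcc_of_le (hx1 i)] at hs
      have hs0 : 0 < s := (hx0 _).trans_le hs.1
      have := hf0 s hs0
      exact norm_of_nonneg (by positivity)
    rw [this]
    refine (hstep (j i)).trans ?_
    have := hE0 (j i)
    have : 0 ≤ E (r * 2 ^ j i) ^ (-p) := by positivity
    gcongr
    linarith

lemma exists_ge_mul_self_eq {f : ℝ → ℝ} (hf : MonotoneOn f (Ici 0))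
    (hfc : ContinuousOn f (Ici 0)) (hf0 : ∀ s, 0 < s → 0 < f s) {s y : ℝ} (hs : 0 < s)
    (hsy : f s * s ≤ y) : ∃ s', s ≤ s' ∧ f s' * s' = y := by
  have hfs := hf0 s hs
  have hy : 0 < y := lt_of_lt_of_le (by positivity) hsy
  have hle : s ≤ y / f s := (le_div_iff₀ hfs).2 (by linarith)
  have hc : ContinuousOn (fun t => f t * t) (Icc s (y / f s)) :=
    (hfc.mono fun t ht => hs.le.trans ht.1).mul continuousOn_id
  obtain ⟨t, ht, hty⟩ := intermediate_value_Icc hle hc ⟨hsy, by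
    have : f s ≤ f (y / f s) := hf hs.le (hs.le.trans hle) hle
    have h2 : f s * (y / f s) = y := by field_simp
    have h3 : 0 < y / f s := by positivity
    nlinarith⟩
  exact ⟨t, ht.1, hty⟩

lemma sub_div_le_integral_Ioi_sub {f : ℝ → ℝ} (hf : MonotoneOn f (Ici 0))
    (hf0 : ∀ s, 0 < s → 0 < f s)
    (hint : IntegrableOn (fun ζ : ℝ => (f ζ * ζ) ^ (-(1 : ℝ) / 2)) (Ioi 1))
    {s s' y : ℝ} (hs : 1 ≤ s) (hss : s ≤ s') (hy : 0 < y) (hs' : f s' * s' = y ^ 2) :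
    (s' - s) / y ≤ (∫ ζ in Ioi s, (f ζ * ζ) ^ (-(1 : ℝ) / 2)) -
      ∫ ζ in Ioi s', (f ζ * ζ) ^ (-(1 : ℝ) / 2) := by
  have hint' := hint.mono_set (Ioi_subset_Ioi hs)
  rw [intervalIntegral.integral_Ioi_sub_Ioi hint' hss, div_eq_mul_inv, ← smul_eq_mul,
    ← intervalIntegral.integral_const]
  refine intervalIntegral.integral_mono_on hss intervalIntegrable_const ?_ fun ζ hζ => ?_
  · exact (intervalIntegrable_iff_integrableOn_Ioc_of_le hss).2
      (hint'.mono_set Ioc_subset_Ioi_self)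
  · have hζ0 : 0 < ζ := by linarith [hζ.1]
    have hfζ := hf0 ζ hζ0
    have h1 : f ζ * ζ ≤ y ^ 2 := by
      rw [← hs']
      have := hf hζ0.le (hζ0.le.trans hζ.2) hζ.2
      exact mul_le_mul this hζ.2 hζ0.le (hfζ.le.trans this)
    have h2 : (y ^ 2) ^ (-(1 : ℝ) / 2) = y⁻¹ := by
      rw [← rpow_natCast, ← rpow_mul hy.le]
      norm_num [rpow_neg_one]
    rw [← h2]
    exact rpow_le_rpow_of_nonpos (by positivity) h1 (by norm_num)

lemma false_of_large_mean {n : ℕ} {f : ℝ → ℝ} (hf : MonotoneOn f (Ici 0))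
    (hfc : ContinuousOn f (Ici 0)) (hf0 : ∀ s, 0 < s → 0 < f s)
    (hint : IntegrableOn (fun ζ : ℝ => (f ζ * ζ) ^ (-(1 : ℝ) / 2)) (Ioi 1))
    {E : ℝ → ℝ} (hEm : MonotoneOn E (Ioi 0)) {c R : ℝ} (hc : 0 < c) (hR : 0 < R)
    (hER : 0 < E R)
    (hE : ∀ r δ, R ≤ r → 0 < δ → r + δ ≤ 2 * R →
      E r + c * R ^ n * δ * f (c * E r * δ / R ^ n) ≤ E (r + δ))
    (hlarge : f 2 * 2 ≤ (E R / R ^ n) ^ 2)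
    (hRT : 2 / c * (3 * ∫ ζ in Ioi 1, (f ζ * ζ) ^ (-(1 : ℝ) / 2)) ≤ R) : False := by
  set T : ℝ → ℝ := fun s => ∫ ζ in Ioi s, (f ζ * ζ) ^ (-(1 : ℝ) / 2) with hT
  have hT0 : ∀ s, 1 ≤ s → 0 ≤ T s := fun s hs =>
    setIntegral_nonneg measurableSet_Ioi fun ζ hζ => by
      have h0 : 0 < ζ := by linarith [show s < ζ from hζ]
      have := hf0 ζ h0
      positivity
  set a := E R / R ^ n with ha
  have ha0 : 0 < a := by positivity
  have hRa : R ^ n * a = E R := by rw [ha]; field_simp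
  have key : ∀ k : ℕ, ∃ r s, R ≤ r ∧ 2 ≤ s ∧ f s * s = (2 ^ k * a) ^ 2 ∧
      2 ^ k * E R ≤ E r ∧ r + 2 / c * (s / (2 ^ k * a) + T s) ≤ 2 * R := by
    intro k
    induction k with
    | zero =>
      obtain ⟨s, hs, hsa⟩ := exists_ge_mul_self_eq hf hfc hf0 two_pos hlarge
      refine ⟨R, s, le_rfl, hs, by simpa using hsa, by simp, ?_⟩
      have h1 := sub_div_le_integral_Ioi_sub hf hf0 hint le_rfl (by linarith) ha0 hsa
      have h2 := hT0 s (by linarith)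
      have h3 : s / a ≤ 2 * ((s - 1) / a) := by
        rw [← mul_div_assoc]; gcongr; linarith
      have h4 : s / a + T s ≤ 3 * T 1 := by
        have h5 := hT0 1 le_rfl
        simp only [hT] at h2 h5 ⊢; linarith
      have h5 : 2 / c * (s / a + T s) ≤ 2 / c * (3 * T 1) := by gcongr
      have h6 : 2 / c * (3 * T 1) ≤ R := hRT
      simp only [pow_zero, one_mul]
      linarith
    | succ k ih =>
      obtain ⟨r, s, hr, hs, hsa, hEr, hpot⟩ := ih
      have hs0 : 0 < s := by linarith
      obtain ⟨y, hy⟩ : ∃ y, y = 2 ^ k * a := ⟨_, rfl⟩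
      have hy0 : 0 < y := by rw [hy]; positivity
      have hy1 : (2 : ℝ) ^ (k + 1) * a = 2 * y := by rw [hy]; ring
      have hRy : 2 ^ k * E R = R ^ n * y := by rw [← hRa, hy]; ring
      rw [← hy] at hsa hpot
      rw [hRy] at hEr
      obtain ⟨s', hss, hs'⟩ := exists_ge_mul_self_eq hf hfc hf0 hs0
        (show f s * s ≤ (2 * y) ^ 2 by rw [hsa]; nlinarith)
      have hTs := hT0 s (by linarith)
      have hδ : 2 / c * (s / y + T s) = 2 * (s / (c * y)) + 2 / c * T s := by
        field_simp
      have hcT : 0 ≤ 2 / c * T s := by positivity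
      have hδ0 : 0 < s / (c * y) := by positivity
      refine ⟨r + s / (c * y), s', by linarith, by linarith, by rw [hy1, hs'], ?_, ?_⟩
      · refine le_trans ?_ (hE r (s / (c * y)) hr hδ0 (by linarith))
        have h1 : s ≤ c * E r * (s / (c * y)) / R ^ n := by
          have : s = c * (R ^ n * y) * (s / (c * y)) / R ^ n := by field_simp
          nth_rewrite 1 [this]
          gcongr
        have h2 := hf hs0.le (hs0.le.trans h1) h1
        have h3 : R ^ n * y = c * R ^ n * (s / (c * y)) * f s := by
          have : c * R ^ n * (s / (c * y)) * f s = R ^ n * (f s * s) / y := by field_simp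
          rw [this, hsa]; field_simp
        have h4 : c * R ^ n * (s / (c * y)) * f s ≤
            c * R ^ n * (s / (c * y)) * f (c * E r * (s / (c * y)) / R ^ n) := by gcongr
        have h5 : (2 : ℝ) ^ (k + 1) * E R = R ^ n * y + R ^ n * y := by
          rw [pow_succ, mul_assoc, mul_comm 2, ← mul_assoc, hRy]; ring
        linarith
      · have h1 := sub_div_le_integral_Ioi_sub hf hf0 hint (by linarith) hss
          (by positivity : 0 < 2 * y) hs'
        rw [hy1]
        refine le_trans ?_ hpot
        have h2 : s / (c * y) = 2 / c * (s / (2 * y)) := by field_simp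
        have h3 : s / y = s / (2 * y) + s / (2 * y) := by field_simp; ring
        rw [h2, h3, add_assoc, ← mul_add]
        have h4 : s / (2 * y) + (s' / (2 * y) + T s') ≤ s / (2 * y) + s / (2 * y) + T s := by
          rw [sub_div] at h1
          simp only [hT]; linarith
        gcongr
  obtain ⟨k, hk⟩ := pow_unbounded_of_one_lt (E (2 * R) / E R) one_lt_two
  obtain ⟨r, s, hr, hs, -, hEr, hpot⟩ := key k
  rw [div_lt_iff₀ hER] at hk
  have h1 := hT0 s (by linarith)
  have h2 : 0 ≤ 2 / c * (s / (2 ^ k * a) + T s) := by positivity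
  have h3 := hEm (hR.trans_le hr) (by linarith : (0 : ℝ) < 2 * R) (by linarith : r ≤ 2 * R)
  linarith

theorem eq_zero_of_growth {n : ℕ} (hn : 2 ≤ n) {f : ℝ → ℝ} (hf : MonotoneOn f (Ici 0))
    (hfc : ContinuousOn f (Ici 0)) (hf0 : ∀ s, 0 < s → 0 < f s)
    (hint : IntegrableOn (fun ζ : ℝ => (f ζ * ζ) ^ (-(1 : ℝ) / 2)) (Ioi 1))
    (hdiv : ¬ IntegrableOn (fun r : ℝ => f r * r ^ (-2 - 2 / ((n : ℝ) - 1))) (Ioo 0 1))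
    {E : ℝ → ℝ} (hEm : MonotoneOn E (Ioi 0)) (hEnn : ∀ r, 0 < r → 0 ≤ E r)
    {c : ℝ} (hc : 0 < c)
    (hE : ∀ R r δ, 0 < R → R ≤ r → 0 < δ → r + δ ≤ 2 * R →
      E r + c * R ^ n * δ * f (c * E r * δ / R ^ n) ≤ E (r + δ)) {r : ℝ} (hr : 0 < r) :
    E r = 0 := by
  by_contra hne
  have hEr : 0 < E r := lt_of_le_of_ne (hEnn r hr) (Ne.symm hne)
  have hdouble : ∀ R, 0 < R → E R + c * R ^ n * R * f (c * E R * R / R ^ n) ≤ E (2 * R) := by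
    intro R hR
    simpa [two_mul] using hE R R R hR le_rfl hR (by linarith)
  have hrj : ∀ j : ℕ, r ≤ r * 2 ^ j := fun j =>
    le_mul_of_one_le_right hr.le (one_le_pow₀ one_le_two)
  have hE0 : ∀ j : ℕ, 0 < E (r * 2 ^ j) := fun j =>
    hEr.trans_le (hEm hr (hr.trans_le (hrj j)) (hrj j))
  obtain ⟨μ, hμ, hμle⟩ := exists_lower_bound_of_doubling hn hf hf0 hdiv hc hr hdouble hE0
  have hfμ := hf0 μ hμ
  have hmean : ∀ j : ℕ, c * f μ * (r * 2 ^ j) / 2 ^ n ≤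
      E (r * 2 ^ (j + 1)) / (r * 2 ^ (j + 1)) ^ n := by
    intro j
    have hρ : 0 < r * 2 ^ j := by positivity
    have h1 := hdouble (r * 2 ^ j) hρ
    have h2 := hf hμ.le (hμ.le.trans (hμle j)) (hμle j)
    have h3 : c * (r * 2 ^ j) ^ n * (r * 2 ^ j) * f μ ≤ E (2 * (r * 2 ^ j)) := by
      refine le_trans ?_ (le_trans (le_add_of_nonneg_left (hE0 j).le) h1)
      gcongr
    rw [show r * 2 ^ (j + 1) = 2 * (r * 2 ^ j) by ring, le_div_iff₀ (by positivity)]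
    refine le_trans (le_of_eq ?_) h3
    rw [mul_pow 2]; field_simp
  have hlim : Tendsto (fun j : ℕ => r * (2 : ℝ) ^ j) atTop atTop :=
    (tendsto_pow_atTop_atTop_of_one_lt one_lt_two).const_mul_atTop hr
  have hlim1 := (tendsto_add_atTop_iff_nat 1).2 hlim
  have hlim2 : Tendsto (fun j : ℕ => c * f μ * (r * 2 ^ j) / 2 ^ n) atTop atTop :=
    (hlim.const_mul_atTop (by positivity)).atTop_div_const (by positivity)
  obtain ⟨j, h1, h2⟩ := ((hlim1.eventually_ge_atTop
    (2 / c * (3 * ∫ ζ in Ioi 1, (f ζ * ζ) ^ (-(1 : ℝ) / 2)))).and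
    (hlim2.eventually_ge_atTop (f 2 * 2 + 1))).exists
  have hf2 := hf0 2 two_pos
  refine false_of_large_mean hf hfc hf0 hint hEm hc (R := r * 2 ^ (j + 1)) (by positivity)
    (hE0 _) (fun r' δ => hE _ r' δ (by positivity)) ?_ h1
  have h3 := h2.trans (hmean j)
  nlinarith

lemma exists_smooth_cutoff : ∃ (g : ℝ → ℝ) (C : ℝ), ContDiff ℝ (⊤ : ℕ∞) g ∧
    (∀ s, 0 ≤ g s) ∧ (∀ s, g s ≤ 1) ∧ (∀ s, s ≤ 0 → g s = 1) ∧ (∀ s, 1 ≤ s → g s = 0) ∧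
    (∀ s, s < 0 ∨ 1 ≤ s → deriv g s = 0 ∧ deriv (deriv g) s = 0) ∧
    ∀ s, |deriv g s| ≤ C ∧ |deriv (deriv g) s| ≤ C := by
  set g : ℝ → ℝ := fun s => Real.smoothTransition (1 - 2 * s) with hg
  have hsm : ContDiff ℝ (⊤ : ℕ∞) g := by
    apply Real.smoothTransition.contDiff.comp
    fun_prop
  have hsm1 : ContDiff ℝ (⊤ : ℕ∞) (deriv g) := (contDiff_infty_iff_deriv.1 hsm).2
  have hsm2 : ContDiff ℝ (⊤ : ℕ∞) (deriv (deriv g)) := (contDiff_infty_iff_deriv.1 hsm1).2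
  have hconst : ∀ s c, g =ᶠ[nhds s] (fun _ => c) →
      deriv g s = 0 ∧ deriv (deriv g) s = 0 := by
    intro s c h
    refine ⟨by rw [h.deriv_eq, deriv_const], ?_⟩
    rw [h.deriv.deriv_eq]
    simp
  have hzero : ∀ s, s < 0 ∨ 1 ≤ s → deriv g s = 0 ∧ deriv (deriv g) s = 0 := by
    rintro s (hs | hs)
    · refine hconst s 1 ?_
      filter_upwards [Iio_mem_nhds hs] with t ht
      exact Real.smoothTransition.one_of_one_le (by linarith [mem_Iio.1 ht])
    · refine hconst s 0 ?_
      filter_upwards [Ioi_mem_nhds (show (1 / 2 : ℝ) < s by linarith)] with t ht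
      exact Real.smoothTransition.zero_of_nonpos (by linarith [mem_Ioi.1 ht])
  obtain ⟨C₁, hC₁⟩ := isCompact_Icc.exists_bound_of_continuousOn
    (s := Icc (0 : ℝ) 1) hsm1.continuous.continuousOn
  obtain ⟨C₂, hC₂⟩ := isCompact_Icc.exists_bound_of_continuousOn
    (s := Icc (0 : ℝ) 1) hsm2.continuous.continuousOn
  refine ⟨g, max C₁ C₂, hsm, fun s => Real.smoothTransition.nonneg _,
    fun s => Real.smoothTransition.le_one _,
    fun s hs => Real.smoothTransition.one_of_one_le (by linarith),
    fun s hs => Real.smoothTransition.zero_of_nonpos (by linarith), hzero, fun s => ?_⟩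
  by_cases hs : s ∈ Icc (0 : ℝ) 1
  · exact ⟨(hC₁ s hs).trans (le_max_left _ _), (hC₂ s hs).trans (le_max_right _ _)⟩
  · have hs' : s < 0 ∨ 1 ≤ s := by
      by_contra! h
      exact hs ⟨h.1, h.2.le⟩
    have h0 : 0 ≤ max C₁ C₂ :=
      (norm_nonneg _).trans ((hC₁ 0 (by simp)).trans (le_max_left _ _))
    rw [(hzero s hs').1, (hzero s hs').2, abs_zero]
    exact ⟨h0, h0⟩

lemma hasDerivAt_norm_add_single_sq {n : ℕ} (x : Spc n) (i : Fin n) :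
    HasDerivAt (fun s : ℝ => ‖x + s • EuclideanSpace.single i (1 : ℝ)‖ ^ 2) (2 * x i) 0 := by
  have h : (fun s : ℝ => ‖x + s • EuclideanSpace.single i (1 : ℝ)‖ ^ 2) =
      fun s => ‖x‖ ^ 2 + s * (2 * x i) + s ^ 2 := by
    funext s
    rw [norm_add_sq_real, inner_smul_right, EuclideanSpace.inner_single_right, norm_smul]
    simp
    ring
  rw [h]
  have := (((hasDerivAt_id (0 : ℝ)).mul_const (2 * x i)).const_add (‖x‖ ^ 2)).fun_add
    (hasDerivAt_pow 2 (0 : ℝ))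
  simpa using this

lemma spDeriv_iterate_two_radial {n : ℕ} {G k : ℝ → ℝ} (hG : ContDiff ℝ (⊤ : ℕ∞) G) (i : Fin n) :
    (spDeriv n i)^[2] (fun z => G (‖z.1‖ ^ 2) * k z.2) = fun z =>
      (deriv (deriv G) (‖z.1‖ ^ 2) * (2 * z.1 i) ^ 2 + deriv G (‖z.1‖ ^ 2) * 2) * k z.2 := by
  have hcomp : ∀ {H : ℝ → ℝ}, ContDiff ℝ (⊤ : ℕ∞) H → ∀ x : Spc n,
      HasDerivAt (fun s : ℝ => H (‖x + s • EuclideanSpace.single i (1 : ℝ)‖ ^ 2))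
        (deriv H (‖x‖ ^ 2) * (2 * x i)) 0 := by
    intro H hH x
    have h1 : HasDerivAt H (deriv H (‖x‖ ^ 2))
        (‖x + (0 : ℝ) • EuclideanSpace.single i (1 : ℝ)‖ ^ 2) := by
      rw [zero_smul, add_zero]
      exact ((hH.differentiable (by simp)) _).hasDerivAt
    exact h1.comp 0 (hasDerivAt_norm_add_single_sq x i)
  have hG1 : ContDiff ℝ (⊤ : ℕ∞) (deriv G) := (contDiff_infty_iff_deriv.1 hG).2
  have h1 : spDeriv n i (fun z => G (‖z.1‖ ^ 2) * k z.2) =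
      fun z => deriv G (‖z.1‖ ^ 2) * (2 * z.1 i) * k z.2 := by
    funext z
    exact ((hcomp hG z.1).mul_const (k z.2)).deriv
  rw [Function.iterate_succ_apply, Function.iterate_one, h1]
  funext z
  have h2 : HasDerivAt (fun s : ℝ => 2 * (z.1 + s • EuclideanSpace.single i (1 : ℝ)) i) 2 0 := by
    have h3 := (((hasDerivAt_id (0 : ℝ)).const_add (z.1 i)).const_mul 2)
    simpa using h3
  have h3 := (((hcomp hG1 z.1).mul h2).mul_const (k z.2)).deriv
  refine h3.trans ?_
  simp only [zero_smul, add_zero]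
  ring

lemma tDeriv_mul_comp_sq {n : ℕ} {G : ℝ → ℝ} {k : Spc n → ℝ} (hG : ContDiff ℝ (⊤ : ℕ∞) G) :
    tDeriv n (fun z => k z.1 * G (z.2 ^ 2)) =
      fun z => k z.1 * (deriv G (z.2 ^ 2) * (2 * z.2)) := by
  funext z
  have h := (((hG.differentiable (by simp)) (z.2 ^ 2)).hasDerivAt.comp z.2
    (hasDerivAt_pow 2 z.2)).const_mul (k z.1)
  refine Eq.trans h.deriv ?_
  simp

lemma tDeriv_iterate_two_mul_comp_sq {n : ℕ} {G : ℝ → ℝ} {k : Spc n → ℝ}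
    (hG : ContDiff ℝ (⊤ : ℕ∞) G) :
    (tDeriv n)^[2] (fun z => k z.1 * G (z.2 ^ 2)) = fun z =>
      k z.1 * (deriv (deriv G) (z.2 ^ 2) * (2 * z.2) ^ 2 + deriv G (z.2 ^ 2) * 2) := by
  have hG1 : ContDiff ℝ (⊤ : ℕ∞) (deriv G) := (contDiff_infty_iff_deriv.1 hG).2
  rw [Function.iterate_succ_apply, Function.iterate_one, tDeriv_mul_comp_sq hG]
  funext z
  have h1 := ((hG1.differentiable (by simp)) (z.2 ^ 2)).hasDerivAt.comp z.2
    (hasDerivAt_pow 2 z.2)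
  have h2 := (hasDerivAt_id z.2).const_mul 2
  have h := (h1.mul h2).const_mul (k z.1)
  refine Eq.trans h.deriv ?_
  simp
  left
  ring

lemma exists_test_function (n : ℕ) : ∃ C : ℝ, 0 < C ∧ ∀ r δ : ℝ, 0 < δ → δ ≤ r →
    ∃ φ : Spc n × ℝ → ℝ, ContDiff ℝ (⊤ : ℕ∞) φ ∧ HasCompactSupport φ ∧ (∀ z, 0 ≤ φ z) ∧
      (∀ z, φ z ≤ 1) ∧ (∀ z ∈ cyl n r 1, φ z = 1) ∧
      (∀ z ∈ halfSp n \ cyl n (r + δ) 1, φ z = 0) ∧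
      (∀ x, tDeriv n φ (x, 0) = 0) ∧
      (∀ z ∈ halfSp n \ (cyl n (r + δ) 1 \ cyl n r 1),
        (tDeriv n)^[2] φ z - ∑ i : Fin n, (spDeriv n i)^[2] φ z = 0) ∧
      ∀ z, |(tDeriv n)^[2] φ z - ∑ i : Fin n, (spDeriv n i)^[2] φ z| ≤ C / δ ^ 2 := by
  obtain ⟨g, C, hsm, hg0, hg1, hgone, hgzero, hgd, hC⟩ := exists_smooth_cutoff
  have hC0 : 0 ≤ C := (abs_nonneg _).trans (hC 0).1
  refine ⟨C * (n + 9) + 1, by positivity, fun r δ hδ hδr => ?_⟩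
  have hr : 0 < r := hδ.trans_le hδr
  obtain ⟨D, hD⟩ : ∃ D, D = 2 * r * δ + δ ^ 2 := ⟨_, rfl⟩
  have hD0 : 0 < D := by rw [hD]; positivity
  set G : ℝ → ℝ := fun y => g ((y - r ^ 2) / D) with hG
  have hGsm : ContDiff ℝ (⊤ : ℕ∞) G := hsm.comp (by fun_prop)
  have hlin : ∀ y, HasDerivAt (fun y : ℝ => (y - r ^ 2) / D) (1 / D) y := fun y =>
    ((hasDerivAt_id y).sub_const _).div_const D
  have hG1 : deriv G = fun y => deriv g ((y - r ^ 2) / D) * (1 / D) := by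
    funext y
    exact (((hsm.differentiable (by simp)) _).hasDerivAt.comp y (hlin y)).deriv
  have hsm1 : ContDiff ℝ (⊤ : ℕ∞) (deriv g) := (contDiff_infty_iff_deriv.1 hsm).2
  have hG2 : deriv (deriv G) = fun y => deriv (deriv g) ((y - r ^ 2) / D) * (1 / D) * (1 / D) := by
    rw [hG1]
    funext y
    exact ((((hsm1.differentiable (by simp)) _).hasDerivAt.comp y (hlin y)).mul_const _).deriv
  have harg1 : ∀ y, (r + δ) ^ 2 ≤ y → 1 ≤ (y - r ^ 2) / D := by
    intro y hy
    rw [le_div_iff₀ hD0, hD]; linarith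
  have harg0 : ∀ y, y < r ^ 2 → (y - r ^ 2) / D < 0 := fun y hy =>
    div_neg_of_neg_of_pos (by linarith) hD0
  have hGout : ∀ y, (r + δ) ^ 2 ≤ y → G y = 0 ∧ deriv G y = 0 ∧ deriv (deriv G) y = 0 := by
    intro y hy
    have h := harg1 y hy
    have h' := hgd _ (Or.inr h)
    exact ⟨hgzero _ h, by simp only [hG1, h'.1, zero_mul],
      by simp only [hG2, h'.2, zero_mul]⟩
  have hGin : ∀ y, y < r ^ 2 → G y = 1 ∧ deriv G y = 0 ∧ deriv (deriv G) y = 0 := by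
    intro y hy
    have h := harg0 y hy
    have h' := hgd _ (Or.inl h)
    exact ⟨hgone _ h.le, by simp only [hG1, h'.1, zero_mul],
      by simp only [hG2, h'.2, zero_mul]⟩
  have hDδ : 1 / D ≤ 1 / (2 * δ ^ 2) := by
    apply one_div_le_one_div_of_le (by positivity)
    rw [hD]; nlinarith
  have hDr : (2 * r * δ) ≤ D := by rw [hD]; nlinarith
  have hb1 : ∀ y, |deriv G y| * 2 ≤ C / δ ^ 2 := by
    intro y
    simp only [hG1]
    rw [abs_mul, abs_of_pos (by positivity : 0 < 1 / D)]
    calc |deriv g ((y - r ^ 2) / D)| * (1 / D) * 2 ≤ C * (1 / (2 * δ ^ 2)) * 2 := by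
          gcongr; exact (hC _).1
      _ = C / δ ^ 2 := by field_simp
  have hb2 : ∀ y, 0 ≤ y → |deriv (deriv G) y| * (4 * y) ≤ 4 * (C / δ ^ 2) := by
    intro y hy
    rcases le_or_gt ((r + δ) ^ 2) y with h | h
    · rw [(hGout y h).2.2, abs_zero, zero_mul]; positivity
    have hy2 : y ≤ 4 * r ^ 2 := by nlinarith
    simp only [hG2]
    rw [mul_assoc, abs_mul, abs_of_pos (by positivity : 0 < 1 / D * (1 / D))]
    have h1 : 1 / D * (1 / D) ≤ 1 / (2 * r * δ) * (1 / (2 * r * δ)) := by gcongr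
    calc |deriv (deriv g) ((y - r ^ 2) / D)| * (1 / D * (1 / D)) * (4 * y)
        ≤ C * (1 / (2 * r * δ) * (1 / (2 * r * δ))) * (4 * (4 * r ^ 2)) := by
          gcongr; exact (hC _).2
      _ = 4 * (C / δ ^ 2) := by field_simp; norm_num
  have hGnn : ∀ y, 0 ≤ G y := fun y => hg0 _
  have hGle : ∀ y, G y ≤ 1 := fun y => hg1 _
  have htt := tDeriv_iterate_two_mul_comp_sq (n := n) (k := fun x => G (‖x‖ ^ 2)) hGsm
  have hxx := fun i : Fin n => spDeriv_iterate_two_radial (k := fun t => G (t ^ 2)) hGsm i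
  have hW : ∀ z : Spc n × ℝ,
      (tDeriv n)^[2] (fun z => G (‖z.1‖ ^ 2) * G (z.2 ^ 2)) z -
        ∑ i : Fin n, (spDeriv n i)^[2] (fun z => G (‖z.1‖ ^ 2) * G (z.2 ^ 2)) z =
      G (‖z.1‖ ^ 2) * (deriv (deriv G) (z.2 ^ 2) * (4 * z.2 ^ 2) + deriv G (z.2 ^ 2) * 2) -
      (deriv (deriv G) (‖z.1‖ ^ 2) * (4 * ‖z.1‖ ^ 2) + n * (deriv G (‖z.1‖ ^ 2) * 2)) *
        G (z.2 ^ 2) := by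
    intro z
    have hs : ‖z.1‖ ^ 2 = ∑ i, z.1 i ^ 2 := EuclideanSpace.real_norm_sq_eq z.1
    have h4 : ∑ i, deriv (deriv G) (‖z.1‖ ^ 2) * (2 * z.1 i) ^ 2 =
        deriv (deriv G) (‖z.1‖ ^ 2) * (4 * ‖z.1‖ ^ 2) := by
      nth_rewrite 3 [hs]
      rw [Finset.mul_sum, Finset.mul_sum]
      exact Finset.sum_congr rfl fun i _ => by ring
    rw [htt]
    simp only [hxx]
    rw [← Finset.sum_mul, Finset.sum_add_distrib, h4, Finset.sum_const, Finset.card_univ,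
      Fintype.card_fin, nsmul_eq_mul]
    ring
  refine ⟨fun z => G (‖z.1‖ ^ 2) * G (z.2 ^ 2), ?_, ?_, fun z => mul_nonneg (hGnn _) (hGnn _),
    fun z => mul_le_one₀ (hGle _) (hGnn _) (hGle _), ?_, ?_, ?_, ?_, ?_⟩
  · exact (hGsm.comp (contDiff_fst.norm_sq ℝ)).mul (hGsm.comp (contDiff_snd.pow 2))
  · refine HasCompactSupport.intro
      (K := Metric.closedBall 0 (r + δ) ×ˢ Icc (-(r + δ)) (r + δ))
      ((isCompact_closedBall _ _).prod isCompact_Icc) fun z hz => ?_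
    rw [mem_prod, not_and_or, mem_closedBall_zero_iff, not_le, mem_Icc,
      ← abs_le, not_le] at hz
    rcases hz with h | h
    · simp only [(hGout (‖z.1‖ ^ 2) (by gcongr)).1, zero_mul]
    · have : (r + δ) ^ 2 ≤ z.2 ^ 2 := by rw [← sq_abs z.2]; gcongr
      simp only [(hGout _ this).1, mul_zero]
  · rintro z ⟨hz1, hz2⟩
    rw [ball0, mem_ball_zero_iff] at hz1
    rw [rpow_one] at hz2
    simp only [(hGin (‖z.1‖ ^ 2) (by gcongr)).1,
      (hGin (z.2 ^ 2) (pow_lt_pow_left₀ hz2.2 hz2.1.le two_ne_zero)).1, mul_one]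
  · rintro z ⟨hz, hzc⟩
    rw [cyl, mem_prod, not_and_or, ball0, mem_ball_zero_iff, rpow_one, not_lt, mem_Ioo,
      not_and, not_lt] at hzc
    rcases hzc with h | h
    · simp only [(hGout (‖z.1‖ ^ 2) (by gcongr)).1, zero_mul]
    · have h' := h hz
      simp only [(hGout (z.2 ^ 2) (by gcongr)).1, mul_zero]
  · intro x
    rw [tDeriv_mul_comp_sq (k := fun x => G (‖x‖ ^ 2)) hGsm]
    simp
  · rintro z ⟨hz, hzc⟩
    rw [hW]
    rw [Set.mem_sdiff, not_and, not_not] at hzc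
    by_cases hzr : z ∈ cyl n (r + δ) 1
    · obtain ⟨hz1, hz2⟩ := hzc hzr
      rw [ball0, mem_ball_zero_iff] at hz1
      rw [rpow_one] at hz2
      have h1 := hGin (‖z.1‖ ^ 2) (by gcongr)
      have h2 := hGin (z.2 ^ 2) (pow_lt_pow_left₀ hz2.2 hz2.1.le two_ne_zero)
      rw [h1.2.1, h1.2.2, h2.2.1, h2.2.2]
      ring
    · rw [cyl, mem_prod, not_and_or, ball0, mem_ball_zero_iff, rpow_one, not_lt, mem_Ioo,
        not_and, not_lt] at hzr
      rcases hzr with h | h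
      · obtain ⟨e0, e1, e2⟩ := hGout (‖z.1‖ ^ 2) (by gcongr)
        rw [e0, e1, e2]; ring
      · have h' := h hz
        obtain ⟨e0, e1, e2⟩ := hGout (z.2 ^ 2) (by gcongr)
        rw [e0, e1, e2]; ring
  · intro z
    rw [hW]
    have hx0 : 0 ≤ ‖z.1‖ ^ 2 := by positivity
    have ht0 : 0 ≤ z.2 ^ 2 := by positivity
    have hB : 0 ≤ C / δ ^ 2 := by positivity
    have h1 : |G (‖z.1‖ ^ 2) * (deriv (deriv G) (z.2 ^ 2) * (4 * z.2 ^ 2) +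
        deriv G (z.2 ^ 2) * 2)| ≤ 1 * (4 * (C / δ ^ 2) + C / δ ^ 2) := by
      rw [abs_mul, abs_of_nonneg (hGnn _)]
      refine mul_le_mul (hGle _) ((abs_add_le _ _).trans ?_) (abs_nonneg _) zero_le_one
      rw [abs_mul, abs_mul _ (2 : ℝ), abs_of_nonneg (by positivity : 0 ≤ 4 * z.2 ^ 2), abs_two]
      exact add_le_add (hb2 _ ht0) (hb1 _)
    have h2 : |(deriv (deriv G) (‖z.1‖ ^ 2) * (4 * ‖z.1‖ ^ 2) +
        n * (deriv G (‖z.1‖ ^ 2) * 2)) * G (z.2 ^ 2)| ≤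
        (4 * (C / δ ^ 2) + n * (C / δ ^ 2)) * 1 := by
      rw [abs_mul, abs_of_nonneg (hGnn _)]
      refine mul_le_mul ((abs_add_le _ _).trans ?_) (hGle _) (hGnn _) (by positivity)
      rw [abs_mul, abs_mul (n : ℝ), abs_mul _ (2 : ℝ),
        abs_of_nonneg (by positivity : 0 ≤ 4 * ‖z.1‖ ^ 2), abs_two, Nat.abs_cast]
      exact add_le_add (hb2 _ hx0) (mul_le_mul_of_nonneg_left (hb1 _) (by positivity))
    refine (abs_sub _ _).trans ((add_le_add h1 h2).trans ?_)
    have h3 : (C * (n + 9) + 1) / δ ^ 2 = C / δ ^ 2 * (n + 9) + 1 / δ ^ 2 := by ring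
    have h4 : 0 ≤ 1 / δ ^ 2 := by positivity
    rw [h3]
    linarith

lemma measurableSet_halfSp (n : ℕ) : MeasurableSet (halfSp n) :=
  measurableSet_lt measurable_const measurable_snd

lemma measurableSet_cyl (n : ℕ) (r κ : ℝ) : MeasurableSet (cyl n r κ) :=
  measurableSet_ball.prod measurableSet_Ioo

lemma cyl_subset_halfSp (n : ℕ) (r κ : ℝ) : cyl n r κ ⊆ halfSp n := fun _ hz => hz.2.1

lemma cyl_one_subset {n : ℕ} {r r' : ℝ} (h : r ≤ r') : cyl n r 1 ⊆ cyl n r' 1 := by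
  rw [cyl, cyl, rpow_one, rpow_one]
  exact prod_mono (Metric.ball_subset_ball h) (Ioo_subset_Ioo_right h)

lemma volume_cyl_ne_top (n : ℕ) (r κ : ℝ) : volume (cyl n r κ) ≠ ⊤ := by
  rw [cyl, Measure.volume_eq_prod, Measure.prod_prod]
  exact ENNReal.mul_ne_top measure_ball_lt_top.ne measure_Ioo_lt_top.ne

lemma volume_real_cyl_one (n : ℕ) {r : ℝ} (hr : 0 < r) :
    volume.real (cyl n r 1) = r ^ (n + 1) * volume.real (Metric.ball (0 : Spc n) 1) := by
  rw [cyl, ball0, measureReal_def, Measure.volume_eq_prod, Measure.prod_prod, rpow_one,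
    Measure.addHaar_ball_of_pos _ _ hr, finrank_euclideanSpace_fin, Real.volume_Ioo, sub_zero,
    ENNReal.toReal_mul, ENNReal.toReal_mul, ENNReal.toReal_ofReal (by positivity),
    ENNReal.toReal_ofReal hr.le, measureReal_def]
  ring

lemma exists_integral_cyl_le (n : ℕ) : ∃ C : ℝ, 0 < C ∧ ∀ (f : ℝ → ℝ) (u0 u1 : Spc n → ℝ)
    (u : Spc n × ℝ → ℝ), (∀ ζ, 0 ≤ ζ → 0 ≤ f ζ) →
    (∀ᵐ x ∂(volume : Measure (Spc n)), 0 ≤ u1 x) → IsGlobalWeakSolWave n f u0 u1 u →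
    ∀ r δ : ℝ, 0 < δ → δ ≤ r → ∫ z in cyl n r 1, f |u z| ≤
      C / δ ^ 2 * ∫ z in cyl n (r + δ) 1 \ cyl n r 1, |u z| := by
  obtain ⟨C, hC, hφ⟩ := exists_test_function n
  refine ⟨C, hC, fun f u0 u1 u hf hu1 ⟨hu, hfu, hweak⟩ r δ hδ hδr => ?_⟩
  have hr : 0 < r := hδ.trans_le hδr
  obtain ⟨φ, hsm, hsupp, hφ0, hφ1, hφin, hφout, hφt, hW0, hWC⟩ := hφ r δ hδ hδr
  have h := hweak φ hsm hsupp hφ0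
  have hinit : 0 ≤ ∫ x : Spc n, (u1 x * φ (x, 0) - u0 x * tDeriv n φ (x, 0)) := by
    refine integral_nonneg_of_ae ?_
    filter_upwards [hu1] with x hx
    rw [hφt, mul_zero, sub_zero]
    exact mul_nonneg hx (hφ0 _)
  have hfφ : IntegrableOn (fun z => f |u z| * φ z) (halfSp n) := by
    refine IntegrableOn.of_forall_sdiff_eq_zero (s := cyl n (r + δ) 1) ?_
      (measurableSet_halfSp n) fun z hz => by rw [hφout z hz, mul_zero]
    refine Integrable.mul_bdd (c := 1) (hfu (r + δ) (by positivity))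
      hsm.continuous.aestronglyMeasurable (Eventually.of_forall fun z => ?_)
    rw [norm_of_nonneg (hφ0 z)]
    exact hφ1 z
  have hlow : ∫ z in cyl n r 1, f |u z| ≤ ∫ z in halfSp n, f |u z| * φ z := by
    rw [setIntegral_congr_fun (g := fun z => f |u z| * φ z) (measurableSet_cyl n r 1)
      fun z hz => by simp only [hφin z hz, mul_one]]
    exact setIntegral_mono_set hfφ
      (Eventually.of_forall fun z => mul_nonneg (hf _ (abs_nonneg _)) (hφ0 z))
      (cyl_subset_halfSp n r 1).eventuallyLE
  have hAm : MeasurableSet (cyl n (r + δ) 1 \ cyl n r 1) :=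
    (measurableSet_cyl _ _ _).diff (measurableSet_cyl _ _ _)
  have hup : ∫ z in halfSp n, u z * ((tDeriv n)^[2] φ z - ∑ i : Fin n, (spDeriv n i)^[2] φ z) ≤
      C / δ ^ 2 * ∫ z in cyl n (r + δ) 1 \ cyl n r 1, |u z| := by
    rw [setIntegral_eq_of_subset_of_forall_sdiff_eq_zero (measurableSet_halfSp n)
      (sdiff_subset.trans (cyl_subset_halfSp n (r + δ) 1))
      fun z hz => by rw [hW0 z hz, mul_zero], ← integral_const_mul]
    refine (Real.le_norm_self _).trans (norm_integral_le_of_norm_le ?_ (Eventually.of_forall fun z => ?_))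
    · exact (((hu (r + δ) (by positivity)).mono_set sdiff_subset).abs).const_mul _
    · rw [norm_mul, mul_comm, norm_eq_abs, norm_eq_abs]
      exact mul_le_mul_of_nonneg_right (hWC z) (abs_nonneg _)
  linarith

lemma continuousOn_Ici_of_monotoneOn_of_convexOn {f : ℝ → ℝ} (hf : MonotoneOn f (Ici 0))
    (hc : ConvexOn ℝ (Ici 0) f) : ContinuousOn f (Ici 0) := by
  intro x hx
  rcases eq_or_lt_of_le (mem_Ici.1 hx) with rfl | hx0
  · have hlim : Tendsto (fun y : ℝ => (1 - y) * f 0 + y * f 1) (nhdsWithin 0 (Ici 0))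
        (nhds (f 0)) := by
      have : Continuous fun y : ℝ => (1 - y) * f 0 + y * f 1 := by fun_prop
      simpa using (this.tendsto 0).mono_left nhdsWithin_le_nhds
    refine tendsto_of_tendsto_of_tendsto_of_le_of_le' tendsto_const_nhds hlim ?_ ?_
    · filter_upwards [self_mem_nhdsWithin] with y hy using hf hx hy hy
    · filter_upwards [self_mem_nhdsWithin, mem_nhdsWithin_of_mem_nhds (Iio_mem_nhds one_pos)]
        with y hy hy1
      have := hc.2 hx (mem_Ici.2 zero_le_one) (sub_nonneg.2 (mem_Iio.1 hy1).le) (mem_Ici.1 hy)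
        (by ring)
      simpa using this
  · have h := hc.continuousOn_interior
    rw [interior_Ici] at h
    exact (h.continuousAt (Ioi_mem_nhds hx0)).continuousWithinAt

lemma pow_succ_sub_pow_succ_bounds (n : ℕ) {R r δ : ℝ} (hR : 0 < R) (hRr : R ≤ r) (hδ : 0 < δ)
    (hrδ : r + δ ≤ 2 * R) :
    R ^ n * δ ≤ (r + δ) ^ (n + 1) - r ^ (n + 1) ∧
      (r + δ) ^ (n + 1) - r ^ (n + 1) ≤ (n + 1) * 2 ^ n * (R ^ n * δ) := by
  have hr : 0 < r := hR.trans_le hRr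
  constructor
  · have h1 : r ^ n * (r + δ) ≤ (r + δ) ^ n * (r + δ) := by gcongr; linarith
    have h2 : R ^ n * δ ≤ r ^ n * δ := by gcongr
    rw [pow_succ, pow_succ]
    linarith
  · have h1 : (r + δ) ^ (n + 1) - r ^ (n + 1) ≤ (n + 1) * (r + δ) ^ n * δ := by
      have hB := one_add_mul_le_pow (a := -(δ / (r + δ))) (by
        have : δ / (r + δ) ≤ 1 := (div_le_one (by positivity)).2 (by linarith)
        linarith) (n + 1)
      have h3 : 1 + -(δ / (r + δ)) = r / (r + δ) := by field_simp; ring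
      rw [h3, div_pow, le_div_iff₀ (by positivity)] at hB
      have h4 : (1 + ((n + 1 : ℕ) : ℝ) * -(δ / (r + δ))) * (r + δ) ^ (n + 1) =
          (r + δ) ^ (n + 1) - (n + 1) * (r + δ) ^ n * δ := by
        push_cast; field_simp; ring
      linarith
    refine h1.trans ?_
    calc ((n : ℝ) + 1) * (r + δ) ^ n * δ ≤ (n + 1) * (2 * R) ^ n * δ := by gcongr
      _ = _ := by rw [mul_pow]; ring

lemma exists_growth_constant {n : ℕ} {f : ℝ → ℝ} (hf : MonotoneOn f (Ici 0))
    (hconv : ConvexOn ℝ (Ici 0) f) (hf0 : ∀ ζ, 0 ≤ ζ → 0 ≤ f ζ) {u0 u1 : Spc n → ℝ}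
    (hu1 : ∀ᵐ x ∂(volume : Measure (Spc n)), 0 ≤ u1 x) {u : Spc n × ℝ → ℝ}
    (hu : IsGlobalWeakSolWave n f u0 u1 u) :
    ∃ c : ℝ, 0 < c ∧ ∀ R r δ, 0 < R → R ≤ r → 0 < δ → r + δ ≤ 2 * R →
      (∫ z in cyl n r 1, f |u z|) +
        c * R ^ n * δ * f (c * (∫ z in cyl n r 1, f |u z|) * δ / R ^ n) ≤
      ∫ z in cyl n (r + δ) 1, f |u z| := by
  obtain ⟨C, hC, hest⟩ := exists_integral_cyl_le n
  have hest := hest f u0 u1 u hf0 hu1 hu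
  set ω := volume.real (Metric.ball (0 : Spc n) 1) with hω
  have hω0 : 0 < ω := ENNReal.toReal_pos (Metric.measure_ball_pos volume _ one_pos).ne' measure_ball_lt_top.ne
  have hK : 0 < C * ((n + 1) * 2 ^ n * ω) := by positivity
  refine ⟨min ω (1 / (C * ((n + 1) * 2 ^ n * ω))), lt_min hω0 (by positivity), ?_⟩
  intro R r δ hR hRr hδ hrδ
  set c := min ω (1 / (C * ((n + 1) * 2 ^ n * ω)))
  have hc0 : 0 < c := lt_min hω0 (by positivity)
  have hr : 0 < r := hR.trans_le hRr
  obtain ⟨hu', hfu, -⟩ := hu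
  have hsub : cyl n r 1 ⊆ cyl n (r + δ) 1 := cyl_one_subset (by linarith)
  set A := cyl n (r + δ) 1 \ cyl n r 1 with hA
  have hE := setIntegral_sdiff (measurableSet_cyl n r 1) (hfu (r + δ) (by positivity)) hsub
  set e := ∫ z in cyl n r 1, f |u z|
  have he0 : 0 ≤ e := setIntegral_nonneg (measurableSet_cyl n r 1) fun z _ => hf0 _ (abs_nonneg _)
  have hV : volume.real A = ((r + δ) ^ (n + 1) - r ^ (n + 1)) * ω := by
    rw [hA, measureReal_sdiff hsub (measurableSet_cyl n r 1) (volume_cyl_ne_top _ _ _),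
      volume_real_cyl_one n hr, volume_real_cyl_one n (by positivity : 0 < r + δ)]
    ring
  obtain ⟨hlow, hup⟩ := pow_succ_sub_pow_succ_bounds n hR hRr hδ hrδ
  have hV1 : ω * (R ^ n * δ) ≤ volume.real A := by rw [hV, mul_comm]; gcongr
  have hV2 : volume.real A ≤ (n + 1) * 2 ^ n * ω * (R ^ n * δ) := by
    rw [hV]
    refine (mul_le_mul_of_nonneg_right hup hω0.le).trans (le_of_eq (by ring))
  have hV0 : 0 < volume.real A := lt_of_lt_of_le (by positivity) hV1
  have hAtop : volume A ≠ ⊤ :=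
    measure_ne_top_of_subset sdiff_subset (volume_cyl_ne_top n (r + δ) 1)
  have hA0 : volume A ≠ 0 := fun h => by
    rw [measureReal_def, h] at hV0
    simp at hV0
  have hJ := hconv.map_set_average_le (f := fun z => |u z|)
    (continuousOn_Ici_of_monotoneOn_of_convexOn hf hconv) isClosed_Ici hA0 hAtop
    (Eventually.of_forall fun z => abs_nonneg (u z))
    (((hu' (r + δ) (by positivity)).mono_set sdiff_subset).abs)
    ((hfu (r + δ) (by positivity)).mono_set sdiff_subset)
  rw [setAverage_eq, setAverage_eq, smul_eq_mul, smul_eq_mul, hE] at hJ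
  have hX := hest r δ hδ (by linarith)
  set X := ∫ z in A, |u z|
  have hX1 : c * e * δ / R ^ n ≤ (volume.real A)⁻¹ * X := by
    have h1 : e * δ ^ 2 / C ≤ X := by
      rw [div_le_iff₀ hC]
      have : C / δ ^ 2 * X = X * C / δ ^ 2 := by ring
      rwa [this, le_div_iff₀ (by positivity)] at hX
    calc c * e * δ / R ^ n ≤ 1 / (C * ((n + 1) * 2 ^ n * ω)) * e * δ / R ^ n := by
          gcongr; exact min_le_right _ _
      _ = ((n + 1) * 2 ^ n * ω * (R ^ n * δ))⁻¹ * (e * δ ^ 2 / C) := by field_simp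
      _ ≤ (volume.real A)⁻¹ * X := by gcongr
  have harg : 0 ≤ c * e * δ / R ^ n := by positivity
  have h2 := hf harg (harg.trans hX1) hX1
  have h3 := h2.trans hJ
  rw [← div_eq_inv_mul, le_div_iff₀ hV0] at h3
  have h4 : c * R ^ n * δ ≤ volume.real A := by
    refine le_trans ?_ hV1
    rw [mul_assoc]
    gcongr
    exact min_le_left _ _
  have h5 := mul_le_mul_of_nonneg_right h4 (hf0 _ harg)
  linarith

lemma trivialSol_of_integral_cyl_eq_zero {n : ℕ} {f : ℝ → ℝ} {u : Spc n × ℝ → ℝ}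
    (hf0 : ∀ ζ, 0 ≤ ζ → 0 ≤ f ζ) (hfpos : ∀ ζ, 0 < ζ → 0 < f ζ)
    (hfu : ∀ r : ℝ, 0 < r → IntegrableOn (fun z => f |u z|) (cyl n r 1))
    (h : ∀ r : ℝ, 0 < r → ∫ z in cyl n r 1, f |u z| = 0) : TrivialSol n u := by
  have hcover : halfSp n ⊆ ⋃ k : ℕ, cyl n ((k : ℝ) + 1) 1 := by
    intro z hz
    obtain ⟨k, hk⟩ := exists_nat_gt (max ‖z.1‖ z.2)
    obtain ⟨hk1, hk2⟩ := max_lt_iff.1 hk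
    refine mem_iUnion.2 ⟨k, ?_, ?_⟩
    · rw [ball0, mem_ball_zero_iff]; linarith
    · rw [rpow_one]; exact ⟨hz, by linarith⟩
  refine ae_restrict_of_ae_restrict_of_subset hcover ?_
  rw [ae_restrict_iUnion_iff]
  intro k
  have hk : (0 : ℝ) < (k : ℝ) + 1 := by positivity
  have h1 := (integral_eq_zero_iff_of_nonneg (fun z => hf0 _ (abs_nonneg (u z)))
    (hfu _ hk)).1 (h _ hk)
  filter_upwards [h1] with z hz
  by_contra hne
  exact (hfpos _ (abs_pos.2 hne)).ne' hz

/-- **Corollary 2.3.** For `n ≥ 2`, if `∫_1^∞ (f(ζ) ζ)^{-1/2} dζ < ∞` and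
`∫_0^1 f(r) r^{-2 - 2/(n-1)} dr = ∞`, then any global weak solution of the wave
problem (WE) is trivial. -/
theorem wave_blowup_higher_dim
    (n : ℕ) (hn : 2 ≤ n)
    (f : ℝ → ℝ) (hf_mono : MonotoneOn f (Ici 0)) (hf_conv : ConvexOn ℝ (Ici 0) f)
    (hf_pos : ∀ ζ : ℝ, 0 < ζ → 0 < f ζ)
    (u0 u1 : Spc n → ℝ) (hu0 : L1locInit n u0) (hu1 : L1locInit n u1)
    (hu1nn : ∀ᵐ x ∂(volume : Measure (Spc n)), 0 ≤ u1 x)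
    (hint : IntegrableOn (fun ζ : ℝ => (f ζ * ζ) ^ (-(1 : ℝ) / 2)) (Ioi 1))
    (hdiv : ¬ IntegrableOn (fun r : ℝ => f r * r ^ (-2 - 2 / ((n : ℝ) - 1))) (Ioo 0 1))
    (u : Spc n × ℝ → ℝ) (hu : IsGlobalWeakSolWave n f u0 u1 u) :
    TrivialSol n u := by
  have hfc := continuousOn_Ici_of_monotoneOn_of_convexOn hf_mono hf_conv
  have hf0 : ∀ ζ, 0 ≤ ζ → 0 ≤ f ζ := by
    intro ζ hζ
    rcases eq_or_lt_of_le hζ with rfl | hζ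
    · refine ge_of_tendsto ((hfc 0 self_mem_Ici).mono_left (nhdsWithin_mono 0 Ioi_subset_Ici_self))
        ?_
      filter_upwards [self_mem_nhdsWithin] with y hy using (hf_pos y hy).le
    · exact (hf_pos ζ hζ).le
  obtain ⟨c, hc, hgrow⟩ := exists_growth_constant hf_mono hf_conv hf0 hu1nn hu
  refine trivialSol_of_integral_cyl_eq_zero hf0 hf_pos hu.2.1 fun r hr => ?_
  refine eq_zero_of_growth hn hf_mono hfc hf_pos hint hdiv
    (E := fun r => ∫ z in cyl n r 1, f |u z|) ?_ ?_ hc hgrow hr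
  · intro r _ r' hr' hrr
    exact setIntegral_mono_set (hu.2.1 r' hr')
      (Eventually.of_forall fun z => hf0 _ (abs_nonneg _)) (cyl_one_subset hrr).eventuallyLE
  · exact fun r _ => setIntegral_nonneg (measurableSet_cyl n r 1) fun z _ => hf0 _ (abs_nonneg _)
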